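/- arXiv:1610.04838 — 2 statements merged into one kernel-verified Lean document; each statement's English description precedes it below -/
import Mathlib

section
/- Let G=(V,E) be a finite directed acyclic graph (DAG) with threshold function t : V → ℕ. Then S* = {v ∈ V : t(v) > d^in(v)} is the unique minimum-cardinality target set for (G,t): S* is a target set, every target set for (G,t) contains S*, and hence the minimum cardinality of a target set for (G,t) equals |S*|. -/
open scoped Classical

noncomputable section

variable {V : Type*}

/-- The in-neighborhood of `u` in the digraph with arc relation `E`. -/
def inNbrs [Fintype V] (E : V → V → Prop) (u : V) : Finset V :=
  Finset.univ.filter fun w => E w u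

/-- The activation process: `activeProcess E t S ℓ = Active[S, ℓ]`. -/
def activeProcess [Fintype V] (E : V → V → Prop) (t : V → ℕ) (S : Finset V) : ℕ → Finset V
  | 0 => S
  | ℓ + 1 =>
      activeProcess E t S ℓ ∪
        Finset.univ.filter fun u => t u ≤ (inNbrs E u ∩ activeProcess E t S ℓ).card

/-- `S` is a target set for the digraph with arc relation `E` and thresholds `t`. -/
def IsTargetSet [Fintype V] (E : V → V → Prop) (t : V → ℕ) (S : Finset V) : Prop :=
  ∃ ℓ : ℕ, activeProcess E t S ℓ = Finset.univ

theorem activeProcess_mono [Fintype V] (E : V → V → Prop) (t : V → ℕ) (S : Finset V) :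
    Monotone (activeProcess E t S) :=
  monotone_nat_of_le_succ fun _ => Finset.subset_union_left

/-- Vertices whose threshold exceeds their in-degree are activated only if they are seeds. -/
theorem mem_of_mem_activeProcess [Fintype V] {E : V → V → Prop} {t : V → ℕ} {S : Finset V}
    {v : V} (hv : (inNbrs E v).card < t v) {l : ℕ} (h : v ∈ activeProcess E t S l) : v ∈ S := by
  induction l with
  | zero => exact h
  | succ l ih =>
    rcases Finset.mem_union.1 h with h | h
    · exact ih h
    · have hle := (Finset.mem_filter.1 h).2
      exact absurd (hle.trans (Finset.card_le_card Finset.inter_subset_left)) hv.not_ge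

theorem IsTargetSet.card_lt_subset [Fintype V] {E : V → V → Prop} {t : V → ℕ} {S : Finset V}
    (hS : IsTargetSet E t S) :
    (Finset.univ.filter fun v => (inNbrs E v).card < t v) ⊆ S := by
  obtain ⟨l, hl⟩ := hS
  intro v hv
  exact mem_of_mem_activeProcess (Finset.mem_filter.1 hv).2 (hl ▸ Finset.mem_univ v)

/-- A set eventually activating every single vertex is a target set. -/
theorem isTargetSet_of_forall_exists_mem [Fintype V] {E : V → V → Prop} {t : V → ℕ}
    {S : Finset V} (h : ∀ v, ∃ l, v ∈ activeProcess E t S l) : IsTargetSet E t S := by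
  choose f hf using h
  exact ⟨Finset.univ.sup f, Finset.eq_univ_iff_forall.2 fun v =>
    activeProcess_mono E t S (Finset.le_sup (Finset.mem_univ v)) (hf v)⟩

theorem isTargetSet_card_lt_of_acyclic [Fintype V] {E : V → V → Prop} (t : V → ℕ)
    (hacyc : ∀ v : V, ¬ Relation.TransGen E v v) :
    IsTargetSet E t (Finset.univ.filter fun v => (inNbrs E v).card < t v) := by
  have : Std.Irrefl (Relation.TransGen E) := ⟨hacyc⟩
  have hwf : WellFounded (Relation.TransGen E) := Finite.wellFounded_of_trans_of_irrefl _
  refine isTargetSet_of_forall_exists_mem fun v => ?_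
  induction v using hwf.induction with
  | _ v ih =>
    by_cases hv : (inNbrs E v).card < t v
    · exact ⟨0, Finset.mem_filter.2 ⟨Finset.mem_univ v, hv⟩⟩
    choose! f hf using ih
    refine ⟨(inNbrs E v).sup f + 1,
      Finset.mem_union_right _ (Finset.mem_filter.2 ⟨Finset.mem_univ v, ?_⟩)⟩
    have hsub : inNbrs E v ⊆ activeProcess E t _ ((inNbrs E v).sup f) := fun w hw =>
      activeProcess_mono E t _ (Finset.le_sup hw) (hf w (.single (Finset.mem_filter.1 hw).2))
    rw [Finset.inter_eq_left.2 hsub]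
    exact not_lt.1 hv

/-- In a DAG, `S* = {v : t(v) > dⁱⁿ(v)}` is the unique minimum target set: it is a target
set, it is contained in every target set, and the minimum target-set size equals `|S*|`. -/
theorem dag_min_target_set [Fintype V] (E : V → V → Prop) (t : V → ℕ)
    (hacyc : ∀ v : V, ¬ Relation.TransGen E v v) :
    IsTargetSet E t (Finset.univ.filter fun v => (inNbrs E v).card < t v) ∧
    (∀ S : Finset V, IsTargetSet E t S →
        (Finset.univ.filter fun v => (inNbrs E v).card < t v) ⊆ S) ∧
    sInf {n : ℕ | ∃ S : Finset V, IsTargetSet E t S ∧ S.card = n} =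
      (Finset.univ.filter fun v => (inNbrs E v).card < t v).card := by
  have hmin := isTargetSet_card_lt_of_acyclic t hacyc
  refine ⟨hmin, fun S hS => hS.card_lt_subset, IsLeast.csInf_eq ⟨⟨_, hmin, rfl⟩, ?_⟩⟩
  rintro _ ⟨S, hS, rfl⟩
  exact Finset.card_le_card hS.card_lt_subset
end
end

section
/- Let G=(V,E) be an Ore graph on n vertices and let t be the threshold function with t(v)=2 for every v ∈ V. Then there exists a target set for (G,t) of cardinality at most 2. -/
open scoped Classical

noncomputable section

variable {V : Type*}

/-- A set is closed under activation with all thresholds 2 when every outside vertex has at most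
one neighbor in it. -/
def IsTwoClosed [Fintype V] (G : SimpleGraph V) (C : Finset V) : Prop :=
  ∀ v, v ∉ C → (inNbrs G.Adj v ∩ C).card ≤ 1

theorem mem_inNbrs_adj [Fintype V] (G : SimpleGraph V) {u w : V} :
    w ∈ inNbrs G.Adj u ↔ G.Adj w u := by
  simp [inNbrs]

theorem subset_activeProcess [Fintype V] (E : V → V → Prop) (t : V → ℕ) (S : Finset V) (ℓ : ℕ) :
    S ⊆ activeProcess E t S ℓ := by
  induction ℓ with
  | zero => exact subset_rfl
  | succ k ih => exact ih.trans Finset.subset_union_left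

theorem exists_activeProcess_stable [Fintype V] (E : V → V → Prop) (t : V → ℕ) (S : Finset V) :
    ∃ ℓ, activeProcess E t S (ℓ + 1) = activeProcess E t S ℓ := by
  by_contra! h
  have hgrow : ∀ ℓ, ℓ ≤ (activeProcess E t S ℓ).card := by
    intro ℓ
    induction ℓ with
    | zero => exact Nat.zero_le _
    | succ k ih =>
      have hss : activeProcess E t S k ⊂ activeProcess E t S (k + 1) :=
        Finset.ssubset_iff_subset_ne.2 ⟨Finset.subset_union_left, (h k).symm⟩
      have := Finset.card_lt_card hss
      omega
  have h1 := hgrow (Fintype.card V + 1)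
  have h2 := Finset.card_le_univ (activeProcess E t S (Fintype.card V + 1))
  omega

theorem exists_activeProcess_isTwoClosed [Fintype V] (G : SimpleGraph V) (S : Finset V) :
    ∃ ℓ, IsTwoClosed G (activeProcess G.Adj (fun _ => 2) S ℓ) := by
  obtain ⟨ℓ, hℓ⟩ := exists_activeProcess_stable G.Adj (fun _ => 2) S
  refine ⟨ℓ, fun v hv => ?_⟩
  by_contra! hlt
  apply hv
  rw [← hℓ]
  exact Finset.mem_union_right _ (Finset.mem_filter.2 ⟨Finset.mem_univ _, hlt⟩)

theorem IsTwoClosed.mem [Fintype V] {G : SimpleGraph V} {C : Finset V} (hC : IsTwoClosed G C)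
    {x y v : V} (hxy : x ≠ y) (hx : x ∈ C) (hy : y ∈ C) (hxv : G.Adj x v) (hyv : G.Adj y v) :
    v ∈ C := by
  by_contra hv
  have h1 : 1 < (inNbrs G.Adj v ∩ C).card :=
    Finset.one_lt_card.2 ⟨x, by simp [mem_inNbrs_adj, *], y, by simp [mem_inNbrs_adj, *], hxy⟩
  have h2 := hC v hv
  omega

theorem card_inNbrs_inter_add_one_le [Fintype V] (G : SimpleGraph V) {u : V} {A : Finset V}
    (hu : u ∈ A) : (inNbrs G.Adj u ∩ A).card + 1 ≤ A.card := by
  have hss : inNbrs G.Adj u ∩ A ⊂ A :=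
    Finset.ssubset_iff_subset_ne.2 ⟨Finset.inter_subset_right, fun h => by
      rw [← h] at hu
      exact G.irrefl ((mem_inNbrs_adj G).1 (Finset.mem_inter.1 hu).1)⟩
  exact Finset.card_lt_card hss

theorem card_inNbrs_inter_add_compl [Fintype V] (G : SimpleGraph V) (u : V) (A : Finset V) :
    (inNbrs G.Adj u ∩ A).card + (inNbrs G.Adj u ∩ Aᶜ).card = (inNbrs G.Adj u).card := by
  rw [← Finset.card_inter_add_card_sdiff (inNbrs G.Adj u) A, Finset.sdiff_eq_inter_compl]

theorem sum_card_inNbrs_inter_comm [Fintype V] (G : SimpleGraph V) (A B : Finset V) :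
    ∑ u ∈ A, (inNbrs G.Adj u ∩ B).card = ∑ v ∈ B, (inNbrs G.Adj v ∩ A).card := by
  convert Finset.sum_card_bipartiteAbove_eq_sum_card_bipartiteBelow (s := A) (t := B) G.Adj
    using 3 with u hu v hv
  · ext w
    simp [mem_inNbrs_adj, Finset.bipartiteAbove, G.adj_comm, and_comm]
  · ext w
    simp [mem_inNbrs_adj, Finset.bipartiteBelow, and_comm]

/-- In an Ore graph, a proper closed set with at least four vertices is never of maximum size
among closed sets that contain given pairs of vertices. -/
theorem IsTwoClosed.exists_pair_card_lt [Fintype V] {G : SimpleGraph V}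
    (hOre : ∀ u v : V, u ≠ v → ¬ G.Adj u v →
      Fintype.card V ≤ (inNbrs G.Adj u).card + (inNbrs G.Adj v).card)
    {A : Finset V} (hA : IsTwoClosed G A) (hfour : 4 ≤ A.card) (hne : A ≠ Finset.univ) :
    ∃ x y : V, ∀ C, IsTwoClosed G C → x ∈ C → y ∈ C → A.card < C.card := by
  have hn : A.card + Aᶜ.card = Fintype.card V := Finset.card_add_card_compl A
  have hout : ∀ u ∈ A, ∀ v ∈ Aᶜ, ¬ G.Adj u v → Aᶜ.card ≤
      (inNbrs G.Adj u ∩ Aᶜ).card + (inNbrs G.Adj v ∩ Aᶜ).card := by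
    intro u hu v hv huv
    have h1 := hOre u v (fun h => Finset.mem_compl.1 hv (h ▸ hu)) huv
    have h2 := card_inNbrs_inter_add_compl G u A
    have h3 := card_inNbrs_inter_add_compl G v A
    have h4 := card_inNbrs_inter_add_one_le G hu
    have h5 := hA v (Finset.mem_compl.1 hv)
    omega
  have hpos : ∀ u ∈ A, 1 ≤ (inNbrs G.Adj u ∩ Aᶜ).card := by
    intro u hu
    by_contra! h0
    obtain ⟨v, hv⟩ : Aᶜ.Nonempty := by
      rwa [Finset.nonempty_iff_ne_empty, Ne, Finset.compl_eq_empty_iff]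
    have huv : ¬ G.Adj u v := fun h => by
      have : v ∈ inNbrs G.Adj u ∩ Aᶜ := Finset.mem_inter.2 ⟨(mem_inNbrs_adj G).2 h.symm, hv⟩
      have := Finset.card_pos.2 ⟨v, this⟩
      omega
    have h1 := hout u hu v hv huv
    have h2 := card_inNbrs_inter_add_one_le G hv
    omega
  obtain ⟨u, hu, hmin⟩ := Finset.exists_min_image A (fun u => (inNbrs G.Adj u ∩ Aᶜ).card)
    (Finset.card_pos.1 (by omega))
  have hcross : A.card * (inNbrs G.Adj u ∩ Aᶜ).card ≤ Aᶜ.card := by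
    calc A.card * (inNbrs G.Adj u ∩ Aᶜ).card
        ≤ ∑ w ∈ A, (inNbrs G.Adj w ∩ Aᶜ).card := by
          rw [← smul_eq_mul]
          exact Finset.card_nsmul_le_sum _ _ _ hmin
      _ = ∑ v ∈ Aᶜ, (inNbrs G.Adj v ∩ A).card := sum_card_inNbrs_inter_comm G _ _
      _ ≤ Aᶜ.card := by
          simpa using Finset.sum_le_card_nsmul Aᶜ _ 1 fun v hv => hA v (Finset.mem_compl.1 hv)
  have hupos := hpos u hu
  set e := (inNbrs G.Adj u ∩ Aᶜ).card with he
  have hdeg : ∀ v ∈ Aᶜ, ¬ G.Adj u v → Aᶜ.card ≤ e + (inNbrs G.Adj v ∩ Aᶜ).card := hout u hu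
  obtain ⟨x, hx, y, hy, hxy⟩ : ∃ x ∈ Aᶜ \ inNbrs G.Adj u, ∃ y ∈ Aᶜ \ inNbrs G.Adj u, x ≠ y := by
    apply Finset.one_lt_card.1
    have := Finset.card_inter_add_card_sdiff Aᶜ (inNbrs G.Adj u)
    rw [Finset.inter_comm] at this
    nlinarith
  simp only [Finset.mem_sdiff, mem_inNbrs_adj, G.adj_comm _ u] at hx hy
  by_cases hbig : A.card + 2 * e < Aᶜ.card + 2
  · refine ⟨x, y, fun C hC hxC hyC => ?_⟩
    have h1 := hdeg x hx.1 hx.2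
    have h2 := hdeg y hy.1 hy.2
    set X := inNbrs G.Adj x ∩ Aᶜ with hX
    set Y := inNbrs G.Adj y ∩ Aᶜ with hY
    have h3 := Finset.card_union_add_card_inter X Y
    have h4 : (X ∪ Y).card ≤ Aᶜ.card :=
      Finset.card_le_card (Finset.union_subset Finset.inter_subset_right Finset.inter_subset_right)
    have hxX : x ∉ X ∩ Y := by simp [hX, mem_inNbrs_adj]
    have hyX : y ∉ X ∩ Y := by simp [hY, mem_inNbrs_adj]
    have h5 : insert x (insert y (X ∩ Y)) ⊆ C := by
      intro v hv
      simp only [Finset.mem_insert, Finset.mem_inter, hX, hY, mem_inNbrs_adj] at hv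
      rcases hv with rfl | rfl | hv
      · exact hxC
      · exact hyC
      · exact hC.mem hxy hxC hyC hv.1.1.symm hv.2.1.symm
    have h6 := Finset.card_le_card h5
    rw [Finset.card_insert_of_notMem (by simp only [Finset.mem_insert]; tauto),
      Finset.card_insert_of_notMem hyX] at h6
    omega
  · have he1 : e = 1 := by
      by_contra h
      have : 2 ≤ e := by omega
      nlinarith
    rw [he1] at hdeg hcross hbig
    have hadj : ∀ v ∈ Aᶜ, ¬ G.Adj u v → ∀ w ∈ Aᶜ, w ≠ v → G.Adj w v := by
      intro v hv huv w hw hwv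
      have h1 := hdeg v hv huv
      have h2 : inNbrs G.Adj v ∩ Aᶜ ⊆ Aᶜ.erase v := by
        intro z hz
        rw [Finset.mem_inter, mem_inNbrs_adj] at hz
        exact Finset.mem_erase.2 ⟨hz.1.ne, hz.2⟩
      have h3 := Finset.eq_of_subset_of_card_le h2 (by rw [Finset.card_erase_of_mem hv]; omega)
      have h4 : w ∈ inNbrs G.Adj v ∩ Aᶜ := h3 ▸ Finset.mem_erase.2 ⟨hwv, hw⟩
      exact (mem_inNbrs_adj G).1 (Finset.mem_inter.1 h4).1
    obtain ⟨z, hz⟩ := Finset.card_eq_one.1 (he.symm.trans he1)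
    have hnbr : ∀ v ∈ Aᶜ, G.Adj u v ↔ v = z := by
      intro v hv
      rw [← Finset.mem_singleton, ← hz, Finset.mem_inter, mem_inNbrs_adj, G.adj_comm]
      simp [hv]
    have hzB : z ∈ Aᶜ := (Finset.mem_inter.1 (hz ▸ Finset.mem_singleton_self z)).2
    have huz : G.Adj u z := (hnbr z hzB).2 rfl
    have hzx : z ≠ x := fun h => hx.2 (h ▸ huz)
    have hux : u ≠ x := fun h => Finset.mem_compl.1 hx.1 (h ▸ hu)
    refine ⟨u, x, fun C hC huC hxC => ?_⟩
    have hzC : z ∈ C := hC.mem hux huC hxC huz (hadj x hx.1 hx.2 z hzB hzx).symm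
    have hBC : insert u Aᶜ ⊆ C := by
      refine Finset.insert_subset huC fun v hv => ?_
      by_contra hvC
      have hvz : v ≠ z := fun h => hvC (h ▸ hzC)
      have hvx : v ≠ x := fun h => hvC (h ▸ hxC)
      have huv : ¬ G.Adj u v := fun h => hvz ((hnbr v hv).1 h)
      exact hvC (hC.mem hzx hzC hxC (hadj v hv huv z hzB hvz.symm)
        (hadj v hv huv x hx.1 hvx.symm))
    have h1 := Finset.card_le_card hBC
    rw [Finset.card_insert_of_notMem (by simpa using hu)] at h1
    omega

/-- In an Ore graph, a closed set containing two nonadjacent vertices has at least four vertices. -/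
theorem IsTwoClosed.four_le_card [Fintype V] {G : SimpleGraph V}
    (hOre : ∀ u v : V, u ≠ v → ¬ G.Adj u v →
      Fintype.card V ≤ (inNbrs G.Adj u).card + (inNbrs G.Adj v).card)
    {C : Finset V} (hC : IsTwoClosed G C) {x y : V} (hxy : x ≠ y) (hadj : ¬ G.Adj x y)
    (hx : x ∈ C) (hy : y ∈ C) : 4 ≤ C.card := by
  have h1 := hOre x y hxy hadj
  have h2 := Finset.card_union_add_card_inter (inNbrs G.Adj x) (inNbrs G.Adj y)
  have hyx : ¬ G.Adj y x := fun h => hadj h.symm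
  have h3 := Finset.card_le_univ (insert x (insert y (inNbrs G.Adj x ∪ inNbrs G.Adj y)))
  rw [Finset.card_insert_of_notMem (by simp [mem_inNbrs_adj, *]),
    Finset.card_insert_of_notMem (by simp [mem_inNbrs_adj, *])] at h3
  have h4 : insert x (insert y (inNbrs G.Adj x ∩ inNbrs G.Adj y)) ⊆ C := by
    intro v hv
    simp only [Finset.mem_insert, Finset.mem_inter, mem_inNbrs_adj] at hv
    rcases hv with rfl | rfl | hv
    · exact hx
    · exact hy
    · exact hC.mem hxy hx hy hv.1.symm hv.2.symm
  have h5 := Finset.card_le_card h4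
  rw [Finset.card_insert_of_notMem (by simp [mem_inNbrs_adj, *]),
    Finset.card_insert_of_notMem (by simp [mem_inNbrs_adj, *])] at h5
  omega

/-- Every Ore graph with all thresholds equal to 2 has a target set of size at most 2. -/
theorem ore_target_set_card_le_two [Fintype V] (G : SimpleGraph V)
    (hOre : ∀ u v : V, u ≠ v → ¬ G.Adj u v → Fintype.card V ≤ G.degree u + G.degree v) :
    ∃ S : Finset V, IsTargetSet G.Adj (fun _ => 2) S ∧ S.card ≤ 2 := by
  have hOre' : ∀ u v : V, u ≠ v → ¬ G.Adj u v →
      Fintype.card V ≤ (inNbrs G.Adj u).card + (inNbrs G.Adj v).card := by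
    have hdeg : ∀ u, (inNbrs G.Adj u).card = G.degree u := by
      intro u
      rw [← G.card_neighborFinset_eq_degree]
      congr 1
      ext w
      simp [mem_inNbrs_adj, G.adj_comm]
    intro u v huv hadj
    simpa only [hdeg] using hOre u v huv hadj
  by_cases hcard : Fintype.card V ≤ 2
  · exact ⟨Finset.univ, ⟨0, rfl⟩, hcard⟩
  choose L hL using exists_activeProcess_isTwoClosed G
  let cl : V × V → Finset V := fun p =>
    activeProcess G.Adj (fun _ => 2) {p.1, p.2} (L {p.1, p.2})
  have hcl : ∀ p, IsTwoClosed G (cl p) := fun p => hL _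
  have hfst : ∀ p, p.1 ∈ cl p := fun p => subset_activeProcess _ _ _ _ (by simp)
  have hsnd : ∀ p, p.2 ∈ cl p := fun p => subset_activeProcess _ _ _ _ (by simp)
  suffices h : ∃ p, cl p = Finset.univ by
    obtain ⟨p, hp⟩ := h
    exact ⟨{p.1, p.2}, ⟨_, hp⟩, Finset.card_le_two⟩
  by_cases hcomplete : ∀ x y : V, x ≠ y → G.Adj x y
  · obtain ⟨x, y, hxy⟩ := Fintype.one_lt_card_iff.1 (by omega : 1 < Fintype.card V)
    refine ⟨(x, y), Finset.eq_univ_iff_forall.2 fun v => ?_⟩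
    by_contra hv
    have hx := hfst (x, y)
    have hy := hsnd (x, y)
    exact hv ((hcl (x, y)).mem hxy hx hy (hcomplete _ _ fun h => hv (h ▸ hx))
      (hcomplete _ _ fun h => hv (h ▸ hy)))
  push Not at hcomplete
  obtain ⟨x, y, hxy, hadj⟩ := hcomplete
  obtain ⟨p, -, hmax⟩ := Finset.exists_max_image Finset.univ (fun p => (cl p).card)
    ⟨(x, y), Finset.mem_univ _⟩
  refine ⟨p, ?_⟩
  by_contra hne
  have hfour := (hcl (x, y)).four_le_card hOre' hxy hadj (hfst _) (hsnd _)
  obtain ⟨x', y', hlt⟩ := (hcl p).exists_pair_card_lt hOre'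
    (hfour.trans (hmax _ (Finset.mem_univ _))) hne
  exact absurd (hlt _ (hcl (x', y')) (hfst _) (hsnd _))
    (not_lt.2 (hmax _ (Finset.mem_univ _)))
end
end
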